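/- arXiv:1205.3562 — 2 statements merged into one kernel-verified Lean document; each statement's English description precedes it below -/
import Mathlib

section
/- (Theorem 3.1) Regularity and singularity are invariant under inversion: for every (u₀,v₀), the point x(u₀,v₀) is a regular point of x (i.e. x_u × x_v ≠ 0 at (u₀,v₀)) if and only if y(u₀,v₀) is a regular point of y (i.e. y_u × y_v ≠ 0 at (u₀,v₀)); equivalently, x_u × x_v vanishes at (u₀,v₀) if and only if y_u × y_v vanishes at (u₀,v₀). -/
noncomputable section
open scoped RealInnerProductSpace

/-- ℝ³ as Euclidean 3-space. -/
abbrev E3 : Type := EuclideanSpace ℝ (Fin 3)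

/-- The cross product on ℝ³. -/
def cross (a b : E3) : E3 :=
  (WithLp.equiv 2 (Fin 3 → ℝ)).symm
    ![a 1 * b 2 - a 2 * b 1, a 2 * b 0 - a 0 * b 2, a 0 * b 1 - a 1 * b 0]

/-- The inversion of ℝ³ with center `c` and radius `r`. -/
def inv3 (c : E3) (r : ℝ) (p : E3) : E3 :=
  c + (r ^ 2 / ‖p - c‖ ^ 2) • (p - c)

/-- Partial derivative in the first variable. -/
def pu {E : Type*} [NormedAddCommGroup E] [NormedSpace ℝ E]
    (x : ℝ → ℝ → E) (u v : ℝ) : E :=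
  deriv (fun t => x t v) u

/-- Partial derivative in the second variable. -/
def pv {E : Type*} [NormedAddCommGroup E] [NormedSpace ℝ E]
    (x : ℝ → ℝ → E) (u v : ℝ) : E :=
  deriv (fun t => x u t) v

/-- The unit normal of a patch. -/
def unormal (x : ℝ → ℝ → E3) (u v : ℝ) : E3 :=
  ‖cross (pu x u v) (pv x u v)‖⁻¹ • cross (pu x u v) (pv x u v)

/-- The conformal factor λ of the inversion along the patch. -/
def lam (c : E3) (r : ℝ) (x : ℝ → ℝ → E3) (u v : ℝ) : ℝ :=
  r ^ 2 / ‖x u v - c‖ ^ 2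

/-- The support-type function η = ⟨U_x, x − c⟩. -/
def eta (c : E3) (x : ℝ → ℝ → E3) (u v : ℝ) : ℝ :=
  ⟪unormal x u v, x u v - c⟫

/-- First fundamental form coefficient E. -/
def FFE (x : ℝ → ℝ → E3) (u v : ℝ) : ℝ := ⟪pu x u v, pu x u v⟫
/-- First fundamental form coefficient F. -/
def FFF (x : ℝ → ℝ → E3) (u v : ℝ) : ℝ := ⟪pu x u v, pv x u v⟫
/-- First fundamental form coefficient G. -/
def FFG (x : ℝ → ℝ → E3) (u v : ℝ) : ℝ := ⟪pv x u v, pv x u v⟫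
/-- Second fundamental form coefficient e. -/
def SFe (x : ℝ → ℝ → E3) (u v : ℝ) : ℝ := ⟪pu (pu x) u v, unormal x u v⟫
/-- Second fundamental form coefficient f. -/
def SFf (x : ℝ → ℝ → E3) (u v : ℝ) : ℝ := ⟪pv (pu x) u v, unormal x u v⟫
/-- Second fundamental form coefficient g. -/
def SFg (x : ℝ → ℝ → E3) (u v : ℝ) : ℝ := ⟪pv (pv x) u v, unormal x u v⟫
/-- Third fundamental form coefficient P. -/
def TFP (x : ℝ → ℝ → E3) (u v : ℝ) : ℝ := ⟪pu (unormal x) u v, pu (unormal x) u v⟫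
/-- Third fundamental form coefficient Q. -/
def TFQ (x : ℝ → ℝ → E3) (u v : ℝ) : ℝ := ⟪pu (unormal x) u v, pv (unormal x) u v⟫
/-- Third fundamental form coefficient R. -/
def TFR (x : ℝ → ℝ → E3) (u v : ℝ) : ℝ := ⟪pv (unormal x) u v, pv (unormal x) u v⟫

/-- Christoffel symbol Γ¹₁₁. -/
def Ch111 (x : ℝ → ℝ → E3) (u v : ℝ) : ℝ :=
  (FFG x u v * pu (FFE x) u v - 2 * FFF x u v * pu (FFF x) u v + FFF x u v * pv (FFE x) u v) /
    (2 * (FFE x u v * FFG x u v - FFF x u v ^ 2))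
/-- Christoffel symbol Γ²₁₁. -/
def Ch211 (x : ℝ → ℝ → E3) (u v : ℝ) : ℝ :=
  (2 * FFE x u v * pu (FFF x) u v - FFE x u v * pv (FFE x) u v - FFF x u v * pu (FFE x) u v) /
    (2 * (FFE x u v * FFG x u v - FFF x u v ^ 2))
/-- Christoffel symbol Γ¹₁₂. -/
def Ch112 (x : ℝ → ℝ → E3) (u v : ℝ) : ℝ :=
  (FFG x u v * pv (FFE x) u v - FFF x u v * pu (FFG x) u v) /
    (2 * (FFE x u v * FFG x u v - FFF x u v ^ 2))
/-- Christoffel symbol Γ²₁₂. -/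
def Ch212 (x : ℝ → ℝ → E3) (u v : ℝ) : ℝ :=
  (FFE x u v * pu (FFG x) u v - FFF x u v * pv (FFE x) u v) /
    (2 * (FFE x u v * FFG x u v - FFF x u v ^ 2))
/-- Christoffel symbol Γ¹₂₂. -/
def Ch122 (x : ℝ → ℝ → E3) (u v : ℝ) : ℝ :=
  (2 * FFG x u v * pv (FFF x) u v - FFG x u v * pu (FFG x) u v - FFF x u v * pv (FFG x) u v) /
    (2 * (FFE x u v * FFG x u v - FFF x u v ^ 2))
/-- Christoffel symbol Γ²₂₂. -/
def Ch222 (x : ℝ → ℝ → E3) (u v : ℝ) : ℝ :=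
  (FFE x u v * pv (FFG x) u v - 2 * FFF x u v * pv (FFF x) u v + FFF x u v * pu (FFG x) u v) /
    (2 * (FFE x u v * FFG x u v - FFF x u v ^ 2))

/-- The tangent map of the inversion at `p`. -/
def phiStar (c : E3) (r : ℝ) (p : E3) (w : E3) : E3 :=
  (r ^ 2 / ‖p - c‖ ^ 2) • w - (2 * r ^ 2 * ⟪p - c, w⟫ / ‖p - c‖ ^ 4) • (p - c)

open EuclideanGeometry

theorem inv3_eq_inversion (c : E3) (r : ℝ) : inv3 c r = inversion c r := by
  funext p
  simp [inv3, inversion, dist_eq_norm, div_pow, add_comm]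

theorem cross_ne_zero_iff_linearIndependent (a b : E3) :
    cross a b ≠ 0 ↔ LinearIndependent ℝ ![a, b] := by
  have hcross : cross a b = WithLp.toLp 2 (crossProduct a.ofLp b.ofLp) := by
    rw [cross_apply]
    rfl
  rw [hcross, Ne, WithLp.toLp_eq_zero, ← Ne, crossProduct_ne_zero_iff_linearIndependent,
    ← (WithLp.linearEquiv 2 ℝ (Fin 3 → ℝ)).toLinearMap.linearIndependent_iff
      (LinearEquiv.ker _)]
  congr! 1
  ext i j
  fin_cases i <;> rfl

theorem LinearMap.cross_ne_zero_iff_of_injective (L : E3 →ₗ[ℝ] E3) (hL : Function.Injective L)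
    (a b : E3) : cross (L a) (L b) ≠ 0 ↔ cross a b ≠ 0 := by
  rw [cross_ne_zero_iff_linearIndependent, cross_ne_zero_iff_linearIndependent,
    ← L.linearIndependent_iff (v := ![a, b]) (LinearMap.ker_eq_bot.mpr hL)]
  congr! 1
  ext i : 1
  fin_cases i <;> rfl

theorem exists_injective_hasFDerivAt_inv3 {c p : E3} {r : ℝ} (hr : r ≠ 0) (hp : p ≠ c) :
    ∃ L : E3 →L[ℝ] E3, Function.Injective L ∧ HasFDerivAt (inv3 c r) L p := by
  refine ⟨_, ?_, inv3_eq_inversion c r ▸ hasFDerivAt_inversion hp⟩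
  have hscale : (r / dist p c) ^ 2 ≠ 0 := pow_ne_zero _ (div_ne_zero hr (dist_ne_zero.mpr hp))
  exact (smul_right_injective E3 hscale).comp (LinearIsometryEquiv.injective _)

theorem inversion_preserves_regularity_and_singularity
    (c : E3) (r : ℝ) (hr : 0 < r)
    (x : ℝ → ℝ → E3)
    (hx : ContDiff ℝ (⊤ : ℕ∞) (fun p : ℝ × ℝ => x p.1 p.2))
    (hxc : ∀ u v : ℝ, x u v ≠ c)
    (y : ℝ → ℝ → E3) (hy : ∀ u v : ℝ, y u v = inv3 c r (x u v)) :
    ∀ u₀ v₀ : ℝ,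
      (cross (pu x u₀ v₀) (pv x u₀ v₀) ≠ 0 ↔ cross (pu y u₀ v₀) (pv y u₀ v₀) ≠ 0) ∧
      (cross (pu x u₀ v₀) (pv x u₀ v₀) = 0 ↔ cross (pu y u₀ v₀) (pv y u₀ v₀) = 0) := by
  intro u v
  obtain ⟨L, hL, hderiv⟩ := exists_injective_hasFDerivAt_inv3 hr.ne' (hxc u v)
  have hdiff : Differentiable ℝ (fun p : ℝ × ℝ => x p.1 p.2) := hx.differentiable (by simp)
  have hdu : DifferentiableAt ℝ (fun t => x t v) u :=
    (hdiff (u, v)).comp (f := fun t => (t, v)) u (by fun_prop)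
  have hdv : DifferentiableAt ℝ (fun t => x u t) v :=
    (hdiff (u, v)).comp (f := fun t => (u, t)) v (by fun_prop)
  have hyu : pu y u v = L (pu x u v) := by
    simp only [pu, hy]
    exact (hderiv.comp_hasDerivAt u hdu.hasDerivAt).deriv
  have hyv : pv y u v = L (pv x u v) := by
    simp only [pv, hy]
    exact (hderiv.comp_hasDerivAt v hdv.hasDerivAt).deriv
  have hiff := L.toLinearMap.cross_ne_zero_iff_of_injective hL (pu x u v) (pv x u v)
  rw [hyu, hyv]
  exact ⟨hiff.symm, (not_iff_not.mp hiff).symm⟩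
end
end

section
/- The coefficients of the second fundamental forms of a patch and of its inverse patch satisfy ẽ = −λe − 2δE, f̃ = −λf − 2δF, and g̃ = −λg − 2δG at every point (u,v), where δ = r²η/‖x − c‖⁴. -/
noncomputable section
open scoped RealInnerProductSpace

section Cross

variable (a b : E3)

theorem inner_cross_self_left : ⟪cross a b, a⟫ = 0 := by
  simp [PiLp.inner_apply, cross, Fin.sum_univ_three]
  ring

theorem inner_cross_self_right : ⟪cross a b, b⟫ = 0 := by
  simp [PiLp.inner_apply, cross, Fin.sum_univ_three]
  ring

/-- The tangent map of the inversion reverses orientation, so it acts on cross products as a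
negative multiple of a reflection. -/
theorem cross_phiStar {c p : E3} (r : ℝ) (hp : p ≠ c) :
    cross (phiStar c r p a) (phiStar c r p b) =
      -(r ^ 2 / ‖p - c‖ ^ 2) ^ 2 •
        (cross a b - (2 * ⟪p - c, cross a b⟫ / ‖p - c‖ ^ 2) • (p - c)) := by
  have hN : ‖p - c‖ ^ 2 ≠ 0 := by simpa [sub_eq_zero] using hp
  unfold phiStar
  generalize p - c = w at *
  have h4 : ‖w‖ ^ 4 = (‖w‖ ^ 2) ^ 2 := by ring
  rw [h4]
  rw [EuclideanSpace.real_norm_sq_eq, Fin.sum_univ_three] at *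
  ext i
  fin_cases i <;>
  · simp [PiLp.inner_apply, cross, Fin.sum_univ_three]
    field_simp
    ring

end Cross

section Reflection

variable {E : Type*} [NormedAddCommGroup E] [InnerProductSpace ℝ E]

theorem norm_sub_two_inner_div_smul {w : E} (hw : w ≠ 0) (m : E) :
    ‖m - (2 * ⟪w, m⟫ / ‖w‖ ^ 2) • w‖ = ‖m‖ := by
  have hN : ‖w‖ ≠ 0 := norm_ne_zero_iff.mpr hw
  rw [← sq_eq_sq₀ (norm_nonneg _) (norm_nonneg _), norm_sub_sq_real, norm_smul, mul_pow,
    inner_smul_right, real_inner_comm, Real.norm_eq_abs, sq_abs]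
  field_simp
  ring

end Reflection

section Inversion

variable {c : E3} {r : ℝ} {f a : ℝ → E3} {f' a' : E3} {t : ℝ}

theorem HasDerivAt.inv3 (hf : HasDerivAt f f' t) (hc : f t ≠ c) :
    HasDerivAt (fun s => _root_.inv3 c r (f s)) (phiStar c r (f t) f') t := by
  have hN : ‖f t - c‖ ≠ 0 := by simpa [sub_eq_zero] using hc
  have hw := hf.sub_const c
  refine ((((hasDerivAt_const t (r ^ 2)).fun_div hw.norm_sq (pow_ne_zero 2 hN)).fun_smul
    hw).const_add c).congr_deriv ?_
  simp only [_root_.phiStar]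
  match_scalars <;> field_simp <;> ring

theorem HasDerivAt.phiStar (hf : HasDerivAt f f' t) (ha : HasDerivAt a a' t) (hc : f t ≠ c) :
    HasDerivAt (fun s => _root_.phiStar c r (f s) (a s))
      ((r ^ 2 / ‖f t - c‖ ^ 2) • a' - (2 * r ^ 2 * ⟪f t - c, f'⟫ / ‖f t - c‖ ^ 4) • a t -
        (2 * r ^ 2 * ⟪f t - c, a t⟫ / ‖f t - c‖ ^ 4) • f' -
        (2 * r ^ 2 * (⟪f', a t⟫ + ⟪f t - c, a'⟫) / ‖f t - c‖ ^ 4 -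
          8 * r ^ 2 * ⟪f t - c, a t⟫ * ⟪f t - c, f'⟫ / ‖f t - c‖ ^ 6) • (f t - c)) t := by
  have hN : ‖f t - c‖ ≠ 0 := by simpa [sub_eq_zero] using hc
  have hw := hf.sub_const c
  have h4 : ∀ s, ‖f s - c‖ ^ 4 = (‖f s - c‖ ^ 2) ^ 2 := fun s => by ring
  simp only [_root_.phiStar, h4]
  refine ((((hasDerivAt_const t (r ^ 2)).fun_div hw.norm_sq (pow_ne_zero 2 hN)).fun_smul
    ha).fun_sub ((((hw.inner ℝ ha).const_mul (2 * r ^ 2)).fun_div (hw.norm_sq.fun_pow 2)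
      (pow_ne_zero 2 (pow_ne_zero 2 hN))).fun_smul hw)).congr_deriv ?_
  match_scalars <;> field_simp <;> ring

/-- The normal component of the derivative of `s ↦ phiStar c r (f s) (a s)`, for `f'` and `a t`
orthogonal to `n`. -/
theorem inner_deriv_phiStar (hf : HasDerivAt f f' t) (ha : HasDerivAt a a' t) (hc : f t ≠ c)
    {n : E3} (hfn : ⟪n, f'⟫ = 0) (han : ⟪n, a t⟫ = 0) :
    ⟪deriv (fun s => phiStar c r (f s) (a s)) t,
        -(n - (2 * ⟪f t - c, n⟫ / ‖f t - c‖ ^ 2) • (f t - c))⟫ =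
      -(r ^ 2 / ‖f t - c‖ ^ 2) * ⟪a', n⟫ -
        2 * (r ^ 2 * ⟪n, f t - c⟫ / ‖f t - c‖ ^ 4) * ⟪a t, f'⟫ := by
  have hN : ‖f t - c‖ ≠ 0 := by simpa [sub_eq_zero] using hc
  rw [(hf.phiStar ha hc).deriv]
  generalize f t - c = w at *
  simp only [inner_neg_right, inner_sub_right, inner_sub_left, real_inner_smul_left,
    real_inner_smul_right, real_inner_self_eq_norm_sq]
  rw [real_inner_comm n (a t), real_inner_comm n f', hfn, han, real_inner_comm (a t) f',
    real_inner_comm n w, real_inner_comm w (a t), real_inner_comm w f', real_inner_comm w a']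
  field_simp
  ring

end Inversion

section Patch

variable {E : Type*} [NormedAddCommGroup E] [NormedSpace ℝ E] {x : ℝ → ℝ → E}

theorem hasDerivAt_pu (hx : ContDiff ℝ (⊤ : ℕ∞) (fun p : ℝ × ℝ => x p.1 p.2)) (u v : ℝ) :
    HasDerivAt (fun t => x t v) (pu x u v) u := by
  have : Differentiable ℝ (fun p : ℝ × ℝ => x p.1 p.2) := hx.differentiable (by simp)
  have h : Differentiable ℝ (fun t => x t v) :=
    this.comp (differentiable_id.prodMk (differentiable_const v))
  exact (h u).hasDerivAt

theorem hasDerivAt_pv (hx : ContDiff ℝ (⊤ : ℕ∞) (fun p : ℝ × ℝ => x p.1 p.2)) (u v : ℝ) :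
    HasDerivAt (fun t => x u t) (pv x u v) v := by
  have : Differentiable ℝ (fun p : ℝ × ℝ => x p.1 p.2) := hx.differentiable (by simp)
  have h : Differentiable ℝ (fun t => x u t) :=
    this.comp ((differentiable_const u).prodMk differentiable_id)
  exact (h v).hasDerivAt

theorem ContDiff.pu (hx : ContDiff ℝ (⊤ : ℕ∞) (fun p : ℝ × ℝ => x p.1 p.2)) :
    ContDiff ℝ (⊤ : ℕ∞) (fun p : ℝ × ℝ => _root_.pu x p.1 p.2) := by
  have h : (fun p : ℝ × ℝ => _root_.pu x p.1 p.2) =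
      fun p => fderiv ℝ (fun p : ℝ × ℝ => x p.1 p.2) p (1, 0) := by
    funext p
    exact ((hx.differentiable (by simp) p).hasFDerivAt.comp_hasDerivAt p.1
      ((hasDerivAt_id p.1).prodMk (hasDerivAt_const p.1 p.2))).deriv
  rw [h]
  exact (hx.fderiv_right (m := (⊤ : ℕ∞)) (by simp)).clm_apply contDiff_const

theorem ContDiff.pv (hx : ContDiff ℝ (⊤ : ℕ∞) (fun p : ℝ × ℝ => x p.1 p.2)) :
    ContDiff ℝ (⊤ : ℕ∞) (fun p : ℝ × ℝ => _root_.pv x p.1 p.2) := by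
  have h : (fun p : ℝ × ℝ => _root_.pv x p.1 p.2) =
      fun p => fderiv ℝ (fun p : ℝ × ℝ => x p.1 p.2) p (0, 1) := by
    funext p
    exact ((hx.differentiable (by simp) p).hasFDerivAt.comp_hasDerivAt p.2
      ((hasDerivAt_const p.2 p.1).prodMk (hasDerivAt_id p.2))).deriv
  rw [h]
  exact (hx.fderiv_right (m := (⊤ : ℕ∞)) (by simp)).clm_apply contDiff_const

end Patch

section UnitNormal

theorem inner_unormal_pu (x : ℝ → ℝ → E3) (u v : ℝ) : ⟪unormal x u v, pu x u v⟫ = 0 := by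
  rw [unormal, real_inner_smul_left, inner_cross_self_left, mul_zero]

theorem inner_unormal_pv (x : ℝ → ℝ → E3) (u v : ℝ) : ⟪unormal x u v, pv x u v⟫ = 0 := by
  rw [unormal, real_inner_smul_left, inner_cross_self_right, mul_zero]

theorem unormal_of_phiStar {c : E3} {r : ℝ} (hr : r ≠ 0) {x y : ℝ → ℝ → E3} {u v : ℝ}
    (hc : x u v ≠ c) (hu : pu y u v = phiStar c r (x u v) (pu x u v))
    (hv : pv y u v = phiStar c r (x u v) (pv x u v)) :
    unormal y u v = -(unormal x u v -
      (2 * ⟪x u v - c, unormal x u v⟫ / ‖x u v - c‖ ^ 2) • (x u v - c)) := by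
  have hN : ‖x u v - c‖ ≠ 0 := by simpa [sub_eq_zero] using hc
  simp only [unormal, hu, hv, cross_phiStar _ _ r hc]
  rw [norm_smul, norm_sub_two_inner_div_smul (sub_ne_zero.mpr hc), norm_neg, norm_pow, norm_div,
    norm_pow, norm_pow, norm_norm, Real.norm_eq_abs, sq_abs, real_inner_smul_right]
  match_scalars <;> field_simp

end UnitNormal

theorem inverse_patch_second_fundamental_form
    (c : E3) (r : ℝ) (hr : 0 < r)
    (x : ℝ → ℝ → E3)
    (hx : ContDiff ℝ (⊤ : ℕ∞) (fun p : ℝ × ℝ => x p.1 p.2))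
    (hxc : ∀ u v : ℝ, x u v ≠ c)
    (y : ℝ → ℝ → E3) (hy : ∀ u v : ℝ, y u v = inv3 c r (x u v))
    (hreg : ∀ u v : ℝ, cross (pu x u v) (pv x u v) ≠ 0) :
    ∀ u v : ℝ,
      SFe y u v = -(lam c r x u v) * SFe x u v -
          2 * (r ^ 2 * eta c x u v / ‖x u v - c‖ ^ 4) * FFE x u v ∧
      SFf y u v = -(lam c r x u v) * SFf x u v -
          2 * (r ^ 2 * eta c x u v / ‖x u v - c‖ ^ 4) * FFF x u v ∧
      SFg y u v = -(lam c r x u v) * SFg x u v -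
          2 * (r ^ 2 * eta c x u v / ‖x u v - c‖ ^ 4) * FFG x u v := by
  have hyu : pu y = fun u v => phiStar c r (x u v) (pu x u v) := by
    funext u v
    simp only [pu, hy]
    exact ((hasDerivAt_pu hx u v).inv3 (hxc u v)).deriv
  have hyv : pv y = fun u v => phiStar c r (x u v) (pv x u v) := by
    funext u v
    simp only [pv, hy]
    exact ((hasDerivAt_pv hx u v).inv3 (hxc u v)).deriv
  intro u v
  have hn := unormal_of_phiStar hr.ne' (hxc u v) (congrFun₂ hyu u v) (congrFun₂ hyv u v)
  have hnu := inner_unormal_pu x u v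
  have hnv := inner_unormal_pv x u v
  refine ⟨?_, ?_, ?_⟩
  · rw [SFe, hn, hyu]
    exact inner_deriv_phiStar (hasDerivAt_pu hx u v) (hasDerivAt_pu hx.pu u v) (hxc u v) hnu hnu
  · rw [SFf, hn, hyu]
    exact inner_deriv_phiStar (hasDerivAt_pv hx u v) (hasDerivAt_pv hx.pu u v) (hxc u v) hnv hnu
  · rw [SFg, hn, hyv]
    exact inner_deriv_phiStar (hasDerivAt_pv hx u v) (hasDerivAt_pv hx.pv u v) (hxc u v) hnv hnv
end
end
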